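/- Let Λ be an Eulerian lattice of rank n and ν∈Λ with ν > 0̂. Then the sum of the weights wt(x) of all chains x in the semisuspension Λ_ν′ that contain the element * equals Σ_{ν ≤ π < 1̂} Ψ_{[0̂,π)} · ((a−b)^{ρ(π,1̂)−1} − a·(a−b)^{ρ(π,1̂)−2}·(1+(−1)^{ρ(π,1̂)})) · b, where for odd ρ(π,1̂) the factor (1+(−1)^{ρ(π,1̂)}) is 0, so the second term is absent. -/

import Mathlib

open scoped Classical

noncomputable section

/-- The ring of polynomials in two non-commuting variables `a`, `b` (with rational
coefficients), in which `ab`-indices and `cd`-indices live. -/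
abbrev NC := FreeAlgebra ℚ (Fin 2)

/-- The variable `a`. -/
def va : NC := FreeAlgebra.ι ℚ 0
/-- The variable `b`. -/
def vb : NC := FreeAlgebra.ι ℚ 1
/-- `c = a + b`. -/
def vc : NC := va + vb
/-- `d = ab + ba`. -/
def vd : NC := va * vb + vb * va

/-- A `cd`-monomial, encoded as a list of booleans (`false` = `c`, `true` = `d`),
viewed inside `NC` via `c = a+b`, `d = ab+ba`. -/
def cdMonomial : List Bool → NC
  | [] => 1
  | s :: w => (if s then vd else vc) * cdMonomial w

/-- Degree of a `cd`-monomial (`c` has degree 1, `d` has degree 2). -/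
def cdDeg (w : List Bool) : ℕ := (w.map fun s => if s then 2 else 1).sum

/-- Evaluation of an integer combination of `cd`-monomials in `NC`. -/
def cdEval (f : List Bool →₀ ℤ) : NC := f.sum fun w z => (z : ℚ) • cdMonomial w

/-- The weight of a chain, computed from the (strictly increasing) list of absolute ranks
of its elements; `N` is the absolute rank of the (possibly formal) maximal element `1̂`.
For a list `[r₀, r₁, …, r_k]` this is
`(a-b)^(r₁-r₀-1) · b · (a-b)^(r₂-r₁-1) · b ⋯ b · (a-b)^(N-1-r_k)`. -/
def wtRanks (N : ℕ) : List ℕ → NC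
  | [] => 1
  | [r] => (va - vb) ^ (N - 1 - r)
  | r :: s :: l => (va - vb) ^ (s - r - 1) * vb * wtRanks N (s :: l)


/-- A finite type has a finite `WithTop`. -/
instance {α : Type*} [Fintype α] : Fintype (WithTop α) := inferInstanceAs (Fintype (Option α))

/-- A lexicographic sum of finite types is finite. -/
instance {α β : Type*} [Fintype α] [Fintype β] : Fintype (α ⊕ₗ β) :=
  inferInstanceAs (Fintype (α ⊕ β))

section Posets

variable {P : Type*} [Fintype P] [PartialOrder P]

/-- `y` is a chain of the subposet `S ⊆ P` whose minimal element is `m`, containing `m`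
(chains of a poset always contain the minimal element `0̂ = m`). -/
def chainIn (S : Set P) (m : P) (y : Finset P) : Prop :=
  m ∈ y ∧ ↑y ⊆ S ∧ IsChain (· < ·) (↑y : Set P)

/-- The `ab`-index `Ψ` of the subposet `S ⊆ P` with minimal element `m`, of rank `n`
(so the adjoined maximal element `1̂` has absolute rank `rk m + n + 1`); ranks of
elements are computed by the ambient rank function `rk`. -/
def absIndexOn (S : Set P) (m : P) (rk : P → ℕ) (n : ℕ) : NC :=
  ∑ y : Finset P,
    if chainIn S m y then wtRanks (rk m + n + 1) ((y.image rk).sort (· ≤ ·)) else 0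

/-- The simplicial boundary operator relative to a chain `x`: a chain `y ⊇ x` is sent to
the signed sum of the chains `y ∖ {σ}` for `σ ∈ y ∖ x`, the sign of `σ` being determined
by its position in `y`.  Together with the grading by cardinality, this is the cellular
(chain) complex of the order complex computing (relative) simplicial homology. -/
def bnd (x : Finset P) : (Finset P →₀ ℝ) →ₗ[ℝ] (Finset P →₀ ℝ) :=
  Finsupp.lsum ℝ fun y => LinearMap.id.smulRight
    (∑ σ ∈ y \ x, ((-1 : ℝ) ^ (y.filter fun τ => τ < σ).card) • Finsupp.single (y.erase σ) (1 : ℝ))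

/-- The degree-`k` term of the cellular complex of (the order complex of) the subposet
`S` with minimal element `m`, relative to the chain `x`: the span of all chains `y ⊇ x`
in `S` with `k` elements. -/
def cellSpace (S : Set P) (m : P) (x : Finset P) (k : ℕ) : Submodule ℝ (Finset P →₀ ℝ) :=
  Submodule.span ℝ
    {f | ∃ y : Finset P, chainIn S m y ∧ x ⊆ y ∧ y.card = k ∧ f = Finsupp.single y 1}

/-- The homological Gorenstein condition for the subposet `S ⊆ P` with minimal element
`m`, of rank `n`: the order complex is a real homology sphere, i.e. for every chain `x`
the cellular complex of the interval `[x, 1̂)` of the order complex is exact except at the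
top (chains of `n+1` elements), where the homology is 1-dimensional. -/
def GorensteinOn (S : Set P) (m : P) (n : ℕ) : Prop :=
  ∀ x : Finset P, chainIn S m x → ∀ k : ℕ,
    Module.finrank ℝ ↥(LinearMap.ker (bnd x) ⊓ cellSpace S m x k) =
      Module.finrank ℝ ↥(Submodule.map (bnd x) (cellSpace S m x (k + 1))) +
        (if k = n + 1 then 1 else 0)

/-- `S ⊆ P` is a graded (sub)poset of rank `n` with minimal element `m`: covers in `S`
increase the ambient rank `rk` by one, and all maximal elements of `S` have rank
`rk m + n`. -/
def IsGradedOn (S : Set P) (m : P) (rk : P → ℕ) (n : ℕ) : Prop :=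
  m ∈ S ∧ (∀ x ∈ S, m ≤ x) ∧
    (∀ a ∈ S, ∀ b ∈ S, a < b → (¬ ∃ c ∈ S, a < c ∧ c < b) → rk b = rk a + 1) ∧
    (∀ a ∈ S, (∀ b ∈ S, ¬ a < b) → rk a = rk m + n)

/-- `S ⊆ P` (with minimal element `m` and ambient rank function `rk`) is a Gorenstein*
poset of rank `n`. -/
def IsGorensteinStarOn (S : Set P) (m : P) (rk : P → ℕ) (n : ℕ) : Prop :=
  IsGradedOn S m rk n ∧ GorensteinOn S m n

/-- The pair `(S, B)` (with minimal element `m` and ambient rank function `rk`) is a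
near-Gorenstein* poset of rank `n` with boundary `B`: `B` is an order ideal of `S` of
rank `n-1` which is Gorenstein* of rank `n-1`, and the order complex of `S` is a real
homology ball with boundary the order complex of `B`: for every chain `x` of `S`, the
cellular complex of `[x, 1̂)` is exact, except that when `x` is not a chain of `B` the
homology at the top is 1-dimensional. -/
def IsNearGorensteinStarOn (S B : Set P) (m : P) (rk : P → ℕ) (n : ℕ) : Prop :=
  IsGradedOn S m rk n ∧ B ⊆ S ∧ (∀ σ ∈ B, ∀ τ ∈ S, τ ≤ σ → τ ∈ B) ∧
    IsGradedOn B m rk (n - 1) ∧ GorensteinOn B m (n - 1) ∧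
    ∀ x : Finset P, chainIn S m x → ∀ k : ℕ,
      Module.finrank ℝ ↥(LinearMap.ker (bnd x) ⊓ cellSpace S m x k) =
        Module.finrank ℝ ↥(Submodule.map (bnd x) (cellSpace S m x (k + 1))) +
          (if k = n + 1 ∧ ¬(↑x ⊆ B) then 1 else 0)

end Posets

end

lemma wtRanks_append_singleton (N s : ℕ) {l : List ℕ} (hl : l ≠ []) :
    wtRanks N (l ++ [s]) = wtRanks s l * vb * (va - vb) ^ (N - 1 - s) := by
  induction l with
  | nil => exact absurd rfl hl
  | cons r l ih =>
    cases l with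
    | nil => simp [wtRanks, Nat.sub_right_comm]
    | cons t l =>
      have := ih (by simp)
      simp only [List.cons_append] at this ⊢
      simp only [wtRanks, this, mul_assoc]

lemma sort_image_insert {P : Type*} [PartialOrder P] {rk : P → ℕ} (hrk : StrictMono rk)
    {σ : P} {y : Finset P} (hy : (↑y : Set P) ⊆ {x | x < σ}) :
    ((insert σ y).image rk).sort (· ≤ ·) = (y.image rk).sort (· ≤ ·) ++ [rk σ] := by
  have hlt : ∀ r ∈ (y.image rk).sort (· ≤ ·), r < rk σ := by
    intro r hr
    rw [Finset.mem_sort, Finset.mem_image] at hr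
    obtain ⟨x, hx, rfl⟩ := hr
    exact hrk (hy hx)
  have hset : (insert σ y).image rk = ((y.image rk).sort (· ≤ ·) ++ [rk σ]).toFinset := by
    ext r
    simp
  rw [hset, List.toFinset_sort]
  · rw [List.pairwise_append]
    refine ⟨Finset.pairwise_sort _ _, List.pairwise_singleton _ _, fun a ha b hb => ?_⟩
    rw [List.mem_singleton] at hb
    exact hb ▸ (hlt a ha).le
  · rw [List.nodup_append]
    refine ⟨Finset.sort_nodup _ _, List.nodup_singleton _, fun a ha b hb => ?_⟩
    rw [List.mem_singleton] at hb
    exact hb ▸ (hlt a ha).ne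

lemma sort_image_ne_nil {P : Type*} [PartialOrder P] [OrderBot P] {rk : P → ℕ} {S : Set P}
    {y : Finset P} (hy : chainIn S ⊥ y) :
    (y.image rk).sort (· ≤ ·) ≠ [] := by
  intro h
  have : rk ⊥ ∈ (y.image rk).sort (· ≤ ·) :=
    (Finset.mem_sort _).2 (Finset.mem_image_of_mem _ hy.1)
  simp [h] at this

lemma sum_withTop {P M : Type*} [Fintype P] [AddCommMonoid M] (f : WithTop P → M) :
    ∑ z : WithTop P, f z = f ⊤ + ∑ z : P, f z :=
  Fintype.sum_option f

section ChainSums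

variable {P : Type*} [Fintype P] [PartialOrder P] [OrderBot P]

/-- Sorting the chains of a lower set by their greatest element. -/
lemma sum_chainIn_eq_sum_greatest {M : Type*} [AddCommMonoid M] {T : Set P} (hT : IsLowerSet T)
    (hbot : ⊥ ∈ T) (f : Finset P → M) :
    (∑ y : Finset P, if chainIn T ⊥ y then f y else 0) =
      f {⊥} + ∑ σ : P, if σ ∈ T ∧ σ ≠ ⊥ then
        ∑ y : Finset P, if chainIn {x : P | x < σ} ⊥ y then f (insert σ y) else 0 else 0 := by
  have h0 : ({⊥} : Finset P) ∈ Finset.univ.filter (fun y : Finset P => chainIn T ⊥ y) := by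
    rw [Finset.mem_filter]
    exact ⟨Finset.mem_univ _, by simp, by simpa using hbot, by simp⟩
  rw [← Finset.sum_filter, ← Finset.add_sum_erase _ _ h0, ← Finset.sum_filter]
  simp only [← Finset.sum_filter]
  rw [Finset.sum_sigma']
  congr 1
  symm
  refine Finset.sum_bij (fun p _ => insert p.1 p.2) ?_ ?_ ?_ (fun _ _ => rfl)
  · rintro ⟨σ, y⟩ h
    simp only [Finset.mem_sigma, Finset.mem_filter, Finset.mem_univ, true_and] at h
    obtain ⟨⟨hσ, hσ0⟩, hy0, hy, hc⟩ := h
    simp only [Finset.mem_erase, Finset.mem_filter, Finset.mem_univ, true_and]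
    refine ⟨fun h => hσ0 ?_, Finset.mem_insert_of_mem hy0, ?_, ?_⟩
    · have : σ ∈ insert σ y := Finset.mem_insert_self _ _
      rw [h] at this
      simpa using this
    · intro x hx
      rcases Finset.mem_insert.1 (Finset.mem_coe.1 hx) with rfl | hx
      · exact hσ
      · exact hT (le_of_lt (hy hx)) hσ
    · rw [Finset.coe_insert]
      exact hc.insert fun b hb _ => Or.inr (hy hb)
  · rintro ⟨σ, y⟩ h ⟨τ, z⟩ h' heq
    simp only [Finset.mem_sigma, Finset.mem_filter, Finset.mem_univ, true_and] at h h' heq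
    obtain ⟨-, -, hy, -⟩ := h
    obtain ⟨-, -, hz, -⟩ := h'
    have hστ : σ = τ := by
      have h1 : σ ∈ insert τ z := heq ▸ Finset.mem_insert_self _ _
      have h2 : τ ∈ insert σ y := heq ▸ Finset.mem_insert_self _ _
      rcases Finset.mem_insert.1 h1 with h1 | h1
      · exact h1
      rcases Finset.mem_insert.1 h2 with h2 | h2
      · exact h2.symm
      exact absurd (hy h2) (lt_asymm (hz h1))
    subst hστ
    have hσy : σ ∉ y := fun h => lt_irrefl _ (hy h)
    have hσz : σ ∉ z := fun h => lt_irrefl _ (hz h)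
    have : y = z := by
      rw [← Finset.erase_insert hσy, heq, Finset.erase_insert hσz]
    rw [this]
  · intro y h
    simp only [Finset.mem_erase, Finset.mem_filter, Finset.mem_univ, true_and] at h
    obtain ⟨hne, hy0, hy, hc⟩ := h
    obtain ⟨σ, hσ⟩ := y.exists_maximal ⟨⊥, hy0⟩
    have hlt : ∀ τ ∈ y, τ ≠ σ → τ < σ := by
      intro τ hτ hτσ
      rcases hc hτ hσ.1 hτσ with h | h
      · exact h
      · exact absurd h (hσ.not_gt hτ)
    have hσ0 : σ ≠ ⊥ := by
      rintro rfl
      refine hne (Finset.eq_singleton_iff_unique_mem.2 ⟨hy0, fun τ hτ => ?_⟩)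
      by_contra hτ0
      exact not_lt_bot (hlt τ hτ hτ0)
    refine ⟨⟨σ, y.erase σ⟩, ?_, Finset.insert_erase hσ.1⟩
    simp only [Finset.mem_sigma, Finset.mem_filter, Finset.mem_univ, true_and]
    refine ⟨⟨hy hσ.1, hσ0⟩, Finset.mem_erase.2 ⟨hσ0.symm, hy0⟩, fun τ hτ => ?_,
      hc.mono (by simp)⟩
    rw [Finset.mem_coe, Finset.mem_erase] at hτ
    exact hlt τ hτ.2 hτ.1

/-- The sum of the weights of the chains of `S`, with the adjoined maximal element at rank `N`. -/
noncomputable def chainWeightSum (S : Set P) (rk : P → ℕ) (N : ℕ) : NC :=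
  ∑ y : Finset P, if chainIn S ⊥ y then wtRanks N ((y.image rk).sort (· ≤ ·)) else 0

/-- The total weight of the chains with greatest element `σ`, including the letter `b`
contributed by `σ`. -/
noncomputable def chainWeightTo (rk : P → ℕ) (σ : P) : NC :=
  if σ = ⊥ then 1 else chainWeightSum {x | x < σ} rk (rk σ) * vb

lemma chainWeightSum_eq_sum {rk : P → ℕ} (hrk : StrictMono rk) (hrk0 : rk ⊥ = 0) {T : Set P}
    (hT : IsLowerSet T) (hbot : ⊥ ∈ T) (N : ℕ) :
    chainWeightSum T rk N =
      ∑ σ : P, if σ ∈ T then chainWeightTo rk σ * (va - vb) ^ (N - 1 - rk σ) else 0 := by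
  rw [chainWeightSum, sum_chainIn_eq_sum_greatest hT hbot, ← Finset.add_sum_erase _ _
    (Finset.mem_univ (⊥ : P)), ← Finset.add_sum_erase _ _ (Finset.mem_univ (⊥ : P))]
  simp only [ne_eq, not_true_eq_false, and_false, if_false, zero_add, if_pos hbot]
  congr 1
  · simp [chainWeightTo, wtRanks, hrk0]
  · refine Finset.sum_congr rfl fun σ hσ => ?_
    have hσ0 : σ ≠ ⊥ := Finset.ne_of_mem_erase hσ
    simp only [hσ0, not_false_eq_true, and_true, chainWeightTo, if_false]
    refine if_congr Iff.rfl ?_ rfl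
    rw [chainWeightSum, Finset.sum_mul, Finset.sum_mul]
    refine Finset.sum_congr rfl fun y _ => ?_
    split_ifs with hy
    · rw [sort_image_insert hrk hy.2.1, wtRanks_append_singleton _ _ (sort_image_ne_nil hy)]
    · simp

end ChainSums

section Graded

variable {P : Type*} [Fintype P] [PartialOrder P] {rk : P → ℕ} {m : P} {n : ℕ}

lemma IsGradedOn.strictMono (h : IsGradedOn (Set.univ : Set P) m rk n) : StrictMono rk := by
  let : LocallyFiniteOrder P := Fintype.toLocallyFiniteOrder
  refine (strictMono_iff_forall_covBy rk).2 fun a b hab => ?_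
  rw [h.2.2.1 a trivial b trivial hab.lt fun ⟨c, _, hac, hcb⟩ => hab.2 hac hcb]
  exact Nat.lt_succ_self _

lemma IsGradedOn.rk_le (h : IsGradedOn (Set.univ : Set P) m rk n) (x : P) : rk x ≤ rk m + n := by
  obtain ⟨y, hxy, hy⟩ := Finite.exists_le_maximal (p := fun _ : P => True) (a := x) trivial
  rw [← h.2.2.2 y trivial fun b _ hb => hy.not_gt trivial hb]
  exact h.strictMono.monotone hxy

lemma sum_Icc_top_eq (rk : P → ℕ) (n : ℕ) (x : P) :
    (∑ z : WithTop P, if (x : WithTop P) ≤ z ∧ z ≤ ⊤ then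
        ((-1 : ℤ) ^ (WithTop.recTopCoe (n + 1) rk z - WithTop.recTopCoe (n + 1) rk (x : WithTop P)))
        else 0) =
      (-1) ^ (n + 1 - rk x) + ∑ z : P, if x ≤ z then (-1 : ℤ) ^ (rk z - rk x) else 0 := by
  rw [sum_withTop]
  simp

/-- The rank of the minimal element of an Eulerian poset is pinned down by that of `1̂`. -/
lemma IsGradedOn.rk_eq_zero (h : IsGradedOn (Set.univ : Set P) m rk n)
    (heul : ∀ x : P, (-1) ^ (n + 1 - rk x) +
      ∑ z : P, (if x ≤ z then (-1 : ℤ) ^ (rk z - rk x) else 0) = 0) : rk m = 0 := by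
  obtain ⟨y, -, hy⟩ := Finite.exists_le_maximal (p := fun _ : P => True) (a := m) trivial
  have hrky := h.2.2.2 y trivial fun b _ hb => hy.not_gt trivial hb
  have hiff : ∀ z, y ≤ z ↔ y = z := fun z => ⟨fun hz => hy.eq_of_le trivial hz, fun hz => hz.le⟩
  have := heul y
  simp only [hiff, Finset.sum_ite_eq, Finset.mem_univ, if_true, hrky] at this
  by_contra hne
  rw [show n + 1 - (rk m + n) = 0 by omega] at this
  simp at this

lemma sum_Ici_neg_one_pow_eq_one (hn : ∀ x, rk x ≤ n) (hmono : Monotone rk) {x : P}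
    (heul : (-1) ^ (n + 1 - rk x) +
      ∑ z : P, (if x ≤ z then (-1 : ℤ) ^ (rk z - rk x) else 0) = 0) :
    ∑ z : P, (if x ≤ z then (-1 : ℤ) ^ (n - rk z) else 0) = 1 := by
  have hsum : ∑ z : P, (if x ≤ z then (-1 : ℤ) ^ (n - rk z) else 0) =
      (-1) ^ (n - rk x) * ∑ z : P, (if x ≤ z then (-1 : ℤ) ^ (rk z - rk x) else 0) := by
    rw [Finset.mul_sum]
    refine Finset.sum_congr rfl fun z _ => ?_
    split_ifs with hz
    · have h1 := hmono hz
      have h2 := hn z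
      rw [show n - rk x = (n - rk z) + (rk z - rk x) by omega, pow_add, mul_assoc, ← pow_add]
      rw [Even.neg_one_pow (Even.add_self _), mul_one]
    · simp
  have hs := hn x
  rw [Nat.succ_sub hs, pow_succ] at heul
  rw [hsum, eq_neg_of_add_eq_zero_right heul, mul_neg_one, neg_neg, ← pow_add,
    Even.neg_one_pow (Even.add_self _)]

end Graded

/-- Expansion of the summand indexed by `π` once the variable `a` is rewritten as `(a - b) + b`. -/
lemma mul_sub_mul_one_add_neg_one_pow (Ψ : NC) {n r : ℕ} (hr : r ≤ n) :
    Ψ * ((va - vb) ^ (n - r) -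
        va * (va - vb) ^ (n - r - 1) * ((1 : NC) + (-1 : NC) ^ (n + 1 - r))) =
      (-1 : ℤ) ^ (n - r) • (Ψ * (va - vb) ^ (n - r)) -
        (1 - (-1 : ℤ) ^ (n - r)) • (Ψ * vb * (va - vb) ^ (n - 1 - r)) := by
  rw [Nat.succ_sub hr, Nat.sub_right_comm n 1 r]
  generalize n - r = k
  rcases k with _ | k
  · simp
  obtain ⟨c, hc⟩ : ∃ c : NC, c = va - vb := ⟨_, rfl⟩
  have ha : va = c + vb := by rw [hc]; abel
  rw [← hc, ha, Nat.add_sub_cancel]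
  rcases Nat.even_or_odd k with hk | hk
  · simp only [pow_succ, hk.neg_one_pow]
    rw [← pow_succ, pow_succ']
    noncomm_ring
  · simp only [pow_succ, hk.neg_one_pow]
    rw [← pow_succ, pow_succ']
    noncomm_ring
    simp

/-- **Proposition.** Let `Λ` be an Eulerian lattice of rank `n` and `ν > 0̂`.  In the
semisuspension `Λ_ν′ = Λ_ν ∪ {*}`, where `*` has rank `n` and lies above exactly the
`σ ∈ Λ_ν` with `ν ≰ σ`, the sum of the weights of all chains containing `*` (each such
chain being a chain of `{σ ∈ Λ_ν | ν ≰ σ}` with `*`, of rank `n`, appended on top) is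
`Σ_{ν ≤ π < 1̂} Ψ_{[0̂,π)} · ((a-b)^{ρ(π,1̂)-1} - a(a-b)^{ρ(π,1̂)-2}(1+(-1)^{ρ(π,1̂)})) · b`. -/
theorem abIndex_lambda_nu_star_chains
    {Λ : Type*} [Fintype Λ] [PartialOrder Λ] [OrderBot Λ]
    (rk : Λ → ℕ) (n : ℕ)
    (j : Λ → Λ → WithTop Λ)
    (hj : ∀ x y : Λ, IsLUB {(↑x : WithTop Λ), ↑y} (j x y))
    (hgr : IsGradedOn (Set.univ : Set Λ) (⊥ : Λ) rk n)
    (heul : ∀ x y : WithTop Λ, x < y →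
      (∑ z : WithTop Λ, if x ≤ z ∧ z ≤ y then
        ((-1 : ℤ) ^ (WithTop.recTopCoe (n + 1) rk z - WithTop.recTopCoe (n + 1) rk x))
        else 0) = 0)
    (ν : Λ) (hν : ⊥ < ν) :
    (∑ y : Finset Λ,
      if chainIn {σ : Λ | j σ ν ≠ ⊤ ∧ ¬ ν ≤ σ} (⊥ : Λ) y then
        wtRanks (n + 1) (((y.image rk).sort (· ≤ ·)) ++ [n])
      else 0) =
      ∑ π : Λ, if ν ≤ π then
        absIndexOn {x : Λ | x < π} (⊥ : Λ) rk (rk π - 1) *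
          ((va - vb) ^ (n - rk π) -
            va * (va - vb) ^ (n - rk π - 1) *
              ((1 : NC) + (-1 : NC) ^ (n + 1 - rk π))) * vb
      else 0 := by
  have hE : ∀ x : Λ, (-1) ^ (n + 1 - rk x) +
      ∑ z : Λ, (if x ≤ z then (-1 : ℤ) ^ (rk z - rk x) else 0) = 0 := fun x => by
    rw [← sum_Icc_top_eq]
    exact heul x ⊤ (WithTop.coe_lt_top x)
  have hrk : StrictMono rk := hgr.strictMono
  have hrk0 : rk ⊥ = 0 := hgr.rk_eq_zero hE
  have hn : ∀ x, rk x ≤ n := fun x => by simpa [hrk0] using hgr.rk_le x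
  have hone := fun x => sum_Ici_neg_one_pow_eq_one hn hrk.monotone (hE x)
  have hle : ∀ x y z : Λ, j x y ≤ z ↔ x ≤ z ∧ y ≤ z := fun x y z => by
    rw [isLUB_le_iff (hj x y)]
    simp [upperBounds]
  set S : Set Λ := {σ : Λ | j σ ν ≠ ⊤ ∧ ¬ ν ≤ σ} with hS
  have hSbot : ⊥ ∈ S := by
    refine ⟨fun h => ?_, hν.not_ge⟩
    have := (hle ⊥ ν ν).2 ⟨bot_le, le_rfl⟩
    rw [h] at this
    simp at this
  have hSlow : IsLowerSet S := by
    rintro σ τ hτσ ⟨h1, h2⟩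
    refine ⟨fun h => ?_, fun h => h2 (h.trans hτσ)⟩
    obtain ⟨ω, hω⟩ := WithTop.ne_top_iff_exists.1 h1
    have h3 := (hle σ ν ω).1 hω.ge
    have h4 := (hle τ ν ω).2 ⟨hτσ.trans h3.1, h3.2⟩
    rw [h] at h4
    simp at h4
  -- The coefficient of the chains with greatest element `σ`.
  have hcoef : ∀ σ : Λ, (∑ π : Λ, if ν ≤ π ∧ σ < π then (-1 : ℤ) ^ (n - rk π) else 0) -
      (if ν ≤ σ then 1 - (-1 : ℤ) ^ (n - rk σ) else 0) = if σ ∈ S then 1 else 0 := by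
    intro σ
    by_cases hνσ : ν ≤ σ
    · have h1 := hone σ
      rw [← Finset.add_sum_erase _ _ (Finset.mem_univ σ), if_pos le_rfl] at h1
      have h2 : ∑ π : Λ, (if ν ≤ π ∧ σ < π then (-1 : ℤ) ^ (n - rk π) else 0) =
          ∑ π ∈ Finset.univ.erase σ, if σ ≤ π then (-1 : ℤ) ^ (n - rk π) else 0 := by
        rw [← Finset.add_sum_erase _ _ (Finset.mem_univ σ), if_neg (fun h => lt_irrefl _ h.2),
          zero_add]
        refine Finset.sum_congr rfl fun π hπ => if_congr ?_ rfl rfl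
        have hne := Finset.ne_of_mem_erase hπ
        exact ⟨fun h => h.2.le, fun h => ⟨hνσ.trans h, lt_of_le_of_ne h hne.symm⟩⟩
      rw [if_pos hνσ, if_neg (fun h : σ ∈ S => h.2 hνσ), h2]
      linarith
    · have hiff : ∀ π, (ν ≤ π ∧ σ < π) ↔ j σ ν ≤ π := fun π => by
        rw [hle]
        exact ⟨fun h => ⟨h.2.le, h.1⟩,
          fun h => ⟨h.2, lt_of_le_of_ne h.1 fun e => hνσ (e ▸ h.2)⟩⟩
      simp only [hiff, if_neg hνσ, sub_zero]
      by_cases hjt : j σ ν = ⊤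
      · rw [if_neg (fun h : σ ∈ S => h.1 hjt)]
        simp [hjt]
      · rw [if_pos (show σ ∈ S from ⟨hjt, hνσ⟩)]
        obtain ⟨ω, hω⟩ := WithTop.ne_top_iff_exists.1 hjt
        simpa [← hω] using hone ω
  set X : Λ → NC := fun σ => chainWeightTo rk σ * (va - vb) ^ (n - 1 - rk σ) with hX
  have hlhs : (∑ y : Finset Λ, if chainIn S (⊥ : Λ) y then
        wtRanks (n + 1) (((y.image rk).sort (· ≤ ·)) ++ [n]) else 0) =
      (∑ σ : Λ, if σ ∈ S then X σ else 0) * vb := by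
    have hsum : (∑ σ : Λ, if σ ∈ S then X σ else 0) = chainWeightSum S rk n := by
      rw [chainWeightSum_eq_sum hrk hrk0 hSlow hSbot]
      refine Finset.sum_congr rfl fun σ _ => ?_
      by_cases hσ : σ ∈ S <;> simp [hσ, hX]
    rw [hsum, chainWeightSum, Finset.sum_mul]
    refine Finset.sum_congr rfl fun y _ => ?_
    split_ifs with hy
    · rw [wtRanks_append_singleton _ _ (sort_image_ne_nil hy)]
      simp
    · simp
  have hterm : ∀ π : Λ, ν ≤ π →
      absIndexOn {x : Λ | x < π} (⊥ : Λ) rk (rk π - 1) *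
          ((va - vb) ^ (n - rk π) - va * (va - vb) ^ (n - rk π - 1) *
              ((1 : NC) + (-1 : NC) ^ (n + 1 - rk π))) =
        (∑ σ : Λ, (if σ < π then (-1 : ℤ) ^ (n - rk π) else 0) • X σ) -
          (1 - (-1 : ℤ) ^ (n - rk π)) • X π := by
    intro π hνπ
    have hπ : ⊥ < π := hν.trans_le hνπ
    have hrkπ : 0 < rk π := hrk0 ▸ hrk hπ
    have habs : absIndexOn {x : Λ | x < π} (⊥ : Λ) rk (rk π - 1) =
        chainWeightSum {x | x < π} rk (rk π) := by
      rw [absIndexOn, chainWeightSum, hrk0, show 0 + (rk π - 1) + 1 = rk π by omega]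
    rw [habs, mul_sub_mul_one_add_neg_one_pow _ (hn π)]
    congr 1
    · rw [chainWeightSum_eq_sum (T := {x | x < π}) hrk hrk0
        (fun a b hba ha => lt_of_le_of_lt hba ha) hπ,
        Finset.sum_mul, Finset.smul_sum]
      refine Finset.sum_congr rfl fun σ _ => ?_
      by_cases hσ : σ < π
      · have h1 := hrk hσ
        have h2 := hn π
        rw [if_pos (show σ ∈ {x | x < π} from hσ), if_pos hσ, mul_assoc, ← pow_add,
          show rk π - 1 - rk σ + (n - rk π) = n - 1 - rk σ by omega]
      · rw [if_neg (show σ ∉ {x | x < π} from hσ), if_neg hσ]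
        simp
    · simp only [hX, chainWeightTo, if_neg hπ.ne']
  rw [hlhs]
  have hrhs : ∀ π : Λ, (if ν ≤ π then
        absIndexOn {x : Λ | x < π} (⊥ : Λ) rk (rk π - 1) *
          ((va - vb) ^ (n - rk π) - va * (va - vb) ^ (n - rk π - 1) *
              ((1 : NC) + (-1 : NC) ^ (n + 1 - rk π))) * vb else 0) =
      ((∑ σ : Λ, (if ν ≤ π ∧ σ < π then (-1 : ℤ) ^ (n - rk π) else 0) • X σ) -
          (if ν ≤ π then 1 - (-1 : ℤ) ^ (n - rk π) else 0) • X π) * vb := by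
    intro π
    by_cases hνπ : ν ≤ π
    · simp only [hνπ, if_true, true_and, hterm π hνπ]
    · simp [hνπ]
  simp only [hrhs]
  rw [← Finset.sum_mul, Finset.sum_sub_distrib, Finset.sum_comm, ← Finset.sum_sub_distrib]
  congr 1
  refine Finset.sum_congr rfl fun σ _ => ?_
  rw [← Finset.sum_smul, ← sub_smul, hcoef σ]
  split_ifs <;> simp
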